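/- The map ∂_{n,r} : 𝒮_r^{(n)} → 𝒬(n)_r is bijective. -/

import Mathlib

/-!
STATEMENT 4.  Fix `v ∈ ℂ*` not a root of unity and `n, r ≥ 1`.  The map
`∂_{n,r} : 𝒮_r^{(n)} → 𝒬(n)_r` is bijective.

Tuples are indexed `0`-based: the `1`-based index `j` corresponds to the Lean index `j - 1`.
-/

noncomputable section

/-- `sclP c q` is the polynomial `u ↦ q(c·u)`. -/
def sclP (c : ℂ) (q : Polynomial ℂ) : Polynomial ℂ := q.comp (Polynomial.C c * Polynomial.X)

/-- Extend a tuple of polynomials by `1` beyond its index range. -/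
def extT {m : ℕ} (Q : Fin m → Polynomial ℂ) (k : ℕ) : Polynomial ℂ :=
  if h : k < m then Q ⟨k, h⟩ else 1

/-- `Q ∈ 𝒬(n)`: each `Q_j` has constant term `1` and each ratio
`Q_j(v^{j-1}u)/Q_{j+1}(v^{j+1}u)` is a polynomial (`0`-based: `j = m + 1`). -/
def DominantT (v : ℂ) {n : ℕ} (Q : Fin n → Polynomial ℂ) : Prop :=
  (∀ i, (Q i).coeff 0 = 1) ∧
    ∀ m : ℕ, m + 1 < n → sclP (v ^ (m + 2)) (extT Q (m + 1)) ∣ sclP (v ^ m) (extT Q m)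

/-- `𝒮_r^{(n)}`: multisets of segments `(a, k)` (center `a ∈ ℂ*`, length `k`) with all lengths
in `[1, n]` and total length `r`. -/
def SegSet (n r : ℕ) : Set (Multiset (ℂ × ℕ)) :=
  {s | (∀ q ∈ s, q.1 ≠ 0 ∧ 1 ≤ q.2 ∧ q.2 ≤ n) ∧ (s.map Prod.snd).sum = r}

/-- `P_i(u) = ∏_{j : μ_j = i} (1 - a_j u)`. -/
def PsegP (s : Multiset (ℂ × ℕ)) (i : ℕ) : Polynomial ℂ :=
  ((s.filter (fun q => q.2 = i)).map
    (fun q => 1 - Polynomial.C q.1 * Polynomial.X)).prod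

/-- `Q_n(u) = ∏_{i : μ_i = n} (1 - a_i v^{-n+1} u)`. -/
def QlastP (v : ℂ) (n : ℕ) (s : Multiset (ℂ × ℕ)) : Polynomial ℂ :=
  ((s.filter (fun q => q.2 = n)).map
    (fun q => 1 - Polynomial.C (q.1 * v ^ (1 - (n : ℤ))) * Polynomial.X)).prod

/-- The map `∂_{n,r}` (with `0`-based index `i`, i.e. `1`-based index `i + 1`):
`Q_{i+1}(u) = ∏_{k=i+1}^{n-1} P_k(u v^{k - 2(i+1) + 1}) · Q_n(u v^{2(n-(i+1))})` (`k` 1-based);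
in particular the last entry is `Q_n = QlastP` (the product is then empty, the scaling trivial). -/
def dsegMap (v : ℂ) (n : ℕ) (s : Multiset (ℂ × ℕ)) : Fin n → Polynomial ℂ :=
  fun i =>
    (∏ k ∈ Finset.Icc ((i : ℕ) + 1) (n - 1),
        sclP (v ^ ((k : ℤ) - 2 * ((i : ℕ) : ℤ) - 1)) (PsegP s k)) *
      sclP (v ^ (2 * ((n : ℤ) - (((i : ℕ) : ℤ) + 1)))) (QlastP v n s)

/-- `𝒬(n)_r`: dominant `n`-tuples whose degrees sum to `r`. -/
def QSet (v : ℂ) (n r : ℕ) : Set (Fin n → Polynomial ℂ) :=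
  {Q | DominantT v Q ∧ ∑ i ∈ Finset.range n, (extT Q i).natDegree = r}

open Polynomial in
lemma sclP_mul (c : ℂ) (p q : ℂ[X]) : sclP c (p * q) = sclP c p * sclP c q := by
  simp [sclP]

open Polynomial in
lemma sclP_prod {ι : Type*} (c : ℂ) (S : Finset ι) (f : ι → ℂ[X]) :
    sclP c (∏ i ∈ S, f i) = ∏ i ∈ S, sclP c (f i) := by
  simp [sclP, Polynomial.prod_comp]

open Polynomial in
lemma sclP_sclP (c d : ℂ) (q : ℂ[X]) : sclP c (sclP d q) = sclP (c * d) q := by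
  unfold sclP
  rw [Polynomial.comp_assoc]
  congr 1
  simp
  ring

open Polynomial in
lemma sclP_one (q : ℂ[X]) : sclP 1 q = q := by simp [sclP]

open Polynomial in
lemma sclP_of_one (c : ℂ) : sclP c (1 : ℂ[X]) = 1 := by simp [sclP]

open Polynomial in
lemma sclP_inj {c : ℂ} (hc : c ≠ 0) {p q : ℂ[X]} (h : sclP c p = sclP c q) : p = q := by
  have := congrArg (sclP c⁻¹) h
  simpa [sclP_sclP, hc, sclP_one] using this

open Polynomial in
lemma sclP_coeff_zero (c : ℂ) (q : ℂ[X]) : (sclP c q).coeff 0 = q.coeff 0 := by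
  simp [sclP, Polynomial.coeff_zero_eq_eval_zero, Polynomial.eval_comp]

open Polynomial in
lemma sclP_natDegree {c : ℂ} (hc : c ≠ 0) (q : ℂ[X]) : (sclP c q).natDegree = q.natDegree := by
  rw [sclP, Polynomial.natDegree_comp, Polynomial.natDegree_C_mul_X c hc, mul_one]

open Polynomial in
lemma ne_zero_of_c0 {q : ℂ[X]} (h : q.coeff 0 = 1) : q ≠ 0 := by
  rintro rfl
  simp at h

open Polynomial in
lemma lin_eq {a : ℂ} (ha : a ≠ 0) : (1 - C a * X : ℂ[X]) = C (-a) * (X - C a⁻¹) := by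
  rw [mul_sub, ← C_mul]
  simp [ha]
  ring

open Polynomial in
lemma PsegP_c0 (s : Multiset (ℂ × ℕ)) (k : ℕ) : (PsegP s k).coeff 0 = 1 := by
  unfold PsegP
  generalize s.filter (fun q => q.2 = k) = t
  induction t using Multiset.induction_on with
  | empty => simp
  | cons a t ih => simp [ih, Polynomial.mul_coeff_zero]

open Polynomial in
lemma linprod_roots (t : Multiset (ℂ × ℕ)) (ht : ∀ q ∈ t, q.1 ≠ 0) :
    (t.map (fun q => (1 - C q.1 * X : ℂ[X]))).prod.roots = t.map (fun q => q.1⁻¹) ∧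
    (t.map (fun q => (1 - C q.1 * X : ℂ[X]))).prod ≠ 0 ∧
    (t.map (fun q => (1 - C q.1 * X : ℂ[X]))).prod.natDegree = t.card := by
  induction t using Multiset.induction_on with
  | empty => simp
  | cons a t ih =>
    have ha : a.1 ≠ 0 := ht a (by simp)
    obtain ⟨h1, h2, h3⟩ := ih (fun q hq => ht q (by simp [hq]))
    have hl : (1 - C a.1 * X : ℂ[X]) ≠ 0 := by
      apply ne_zero_of_c0
      simp
    have hne := mul_ne_zero hl h2
    simp only [Multiset.map_cons, Multiset.prod_cons, Multiset.card_cons]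
    refine ⟨?_, hne, ?_⟩
    · rw [Polynomial.roots_mul hne, h1, lin_eq ha, Polynomial.roots_C_mul _ (neg_ne_zero.mpr ha),
        Polynomial.roots_X_sub_C, Multiset.singleton_add]
    · rw [Polynomial.natDegree_mul hl h2, h3, lin_eq ha,
        Polynomial.natDegree_C_mul (neg_ne_zero.mpr ha), Polynomial.natDegree_X_sub_C, add_comm]

open Polynomial in
lemma filter_eq_roots (s : Multiset (ℂ × ℕ)) (hs : ∀ q ∈ s, q.1 ≠ 0) (k : ℕ) :
    s.filter (fun q => q.2 = k) = (PsegP s k).roots.map (fun x => (x⁻¹, k)) := by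
  unfold PsegP
  rw [(linprod_roots _ (fun q hq => hs q (Multiset.mem_of_mem_filter hq))).1, Multiset.map_map]
  conv_lhs => rw [← Multiset.map_id (s.filter (fun q => q.2 = k))]
  apply Multiset.map_congr rfl
  rintro ⟨a, j⟩ hq
  have := (Multiset.mem_filter.mp hq).2
  simp at this
  simp [this]

open Polynomial in
lemma prod_roots_eq (p : ℂ[X]) (hp : p.coeff 0 = 1) :
    (p.roots.map (fun x => (1 - C x⁻¹ * X : ℂ[X]))).prod = p := by
  have hs : p.Splits := IsAlgClosed.splits p
  have h := hs.eq_prod_roots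
  have h0 : ∀ x ∈ p.roots, x ≠ 0 := by
    rintro x hx rfl
    have := (Polynomial.mem_roots'.mp hx).2
    rw [Polynomial.IsRoot, ← Polynomial.coeff_zero_eq_eval_zero, hp] at this
    simp at this
  have key : ∀ t : Multiset ℂ, (∀ x ∈ t, x ≠ 0) → ∃ c : ℂ,
      (t.map (fun x => (1 - C x⁻¹ * X : ℂ[X]))).prod = C c * (t.map (fun x => X - C x)).prod ∧
      (t.map (fun x => (1 - C x⁻¹ * X : ℂ[X]))).prod.coeff 0 = 1 ∧ c ≠ 0 := by
    intro t
    induction t using Multiset.induction_on with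
    | empty => intro _; exact ⟨1, by simp⟩
    | cons a t ih =>
      intro ht
      obtain ⟨c, h1, h2, h3⟩ := ih (fun q hq => ht q (by simp [hq]))
      have ha : a ≠ 0 := ht a (by simp)
      refine ⟨-a⁻¹ * c, ?_, ?_, ?_⟩
      · simp only [Multiset.map_cons, Multiset.prod_cons]
        rw [h1, lin_eq (inv_ne_zero ha), inv_inv, C_mul]
        ring
      · simp [Polynomial.mul_coeff_zero, h2]
      · simp [ha, h3]
  obtain ⟨c, h1, h2, h3⟩ := key _ h0
  set R := (p.roots.map (fun x => (1 - C x⁻¹ * X : ℂ[X]))).prod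
  set S := (p.roots.map (fun x => X - C x)).prod
  have e1 : c * S.coeff 0 = 1 := by rw [← h2, h1]; simp
  have e2 : p.leadingCoeff * S.coeff 0 = 1 := by
    rw [← hp]
    conv_rhs => rw [h]
    simp [S]
  have hS : S.coeff 0 ≠ 0 := right_ne_zero_of_mul_eq_one e1
  have : c = p.leadingCoeff := mul_right_cancel₀ hS (e1.trans e2.symm)
  rw [h1, this]
  exact h.symm

/-- Uniform form of the map. -/
def DD (v : ℂ) (n : ℕ) (P : ℕ → Polynomial ℂ) (i : ℕ) : Polynomial ℂ :=
  ∏ k ∈ Finset.Icc (i + 1) n, sclP (v ^ ((k : ℤ) - 2 * (i : ℤ) - 1)) (P k)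

open Polynomial in
lemma QlastP_eq (v : ℂ) (n : ℕ) (s : Multiset (ℂ × ℕ)) :
    QlastP v n s = sclP (v ^ (1 - (n : ℤ))) (PsegP s n) := by
  unfold QlastP PsegP
  generalize s.filter (fun q => q.2 = n) = t
  induction t using Multiset.induction_on with
  | empty => simp [sclP_of_one]
  | cons a t ih =>
    simp only [Multiset.map_cons, Multiset.prod_cons, sclP_mul]
    rw [ih]
    congr 1
    simp [sclP]
    ring

lemma dsegMap_eq (v : ℂ) (hv : v ≠ 0) (n : ℕ) (s : Multiset (ℂ × ℕ)) (i : Fin n) :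
    dsegMap v n s i = DD v n (PsegP s) i := by
  have hi := i.2
  obtain ⟨m, rfl⟩ : ∃ m, n = m + 1 := ⟨n - 1, by omega⟩
  unfold dsegMap DD
  rw [Finset.prod_Icc_succ_top (by omega), QlastP_eq, sclP_sclP, ← zpow_add₀ hv]
  simp only [Nat.add_sub_cancel]
  congr 3
  push_cast
  ring

lemma extT_eq (v : ℂ) (hv : v ≠ 0) (n : ℕ) (s : Multiset (ℂ × ℕ)) (i : ℕ) :
    extT (dsegMap v n s) i = DD v n (PsegP s) i := by
  unfold extT
  split_ifs with h
  · exact dsegMap_eq v hv n s ⟨i, h⟩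
  · rw [DD, Finset.Icc_eq_empty (by omega), Finset.prod_empty]

lemma DD_rec (v : ℂ) (hv : v ≠ 0) (n : ℕ) (P : ℕ → Polynomial ℂ) (i : ℕ) (hi : i < n) :
    sclP (v ^ i) (DD v n P i) = sclP (v ^ (i + 2)) (DD v n P (i + 1)) * P (i + 1) := by
  unfold DD
  have hI : Finset.Icc (i + 1) n = insert (i + 1) (Finset.Icc (i + 1 + 1) n) := by
    ext x
    simp only [Finset.mem_Icc, Finset.mem_insert]
    omega
  rw [hI, Finset.prod_insert (by simp), sclP_mul, sclP_prod, sclP_prod, mul_comm]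
  congr 1
  · apply Finset.prod_congr rfl
    intro k _
    rw [sclP_sclP, sclP_sclP, ← zpow_natCast, ← zpow_natCast, ← zpow_add₀ hv, ← zpow_add₀ hv]
    congr 2
    push_cast
    ring
  · rw [sclP_sclP, ← zpow_natCast, ← zpow_add₀ hv]
    have : ((i : ℕ) : ℤ) + (((i + 1 : ℕ) : ℤ) - 2 * (i : ℤ) - 1) = 0 := by
      push_cast
      ring
    rw [this, zpow_zero, sclP_one]

lemma DD_c0 (v : ℂ) (n : ℕ) (P : ℕ → Polynomial ℂ) (hP : ∀ k, (P k).coeff 0 = 1) (i : ℕ) :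
    (DD v n P i).coeff 0 = 1 := by
  rw [DD, Polynomial.coeff_zero_prod]
  apply Finset.prod_eq_one
  intro k _
  rw [sclP_coeff_zero, hP]

lemma sum_count (n : ℕ) (s : Multiset (ℂ × ℕ)) (hs : ∀ q ∈ s, q.2 ≤ n) :
    ∑ i ∈ Finset.range n, ∑ k ∈ Finset.Icc (i + 1) n,
      (s.filter (fun q => q.2 = k)).card = (s.map Prod.snd).sum := by
  induction s using Multiset.induction_on with
  | empty => simp
  | cons a t ih =>
    have ha := hs a (by simp)
    have ih := ih (fun q hq => hs q (by simp [hq]))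
    simp only [← Multiset.countP_eq_card_filter] at ih ⊢
    simp only [Multiset.countP_cons, Finset.sum_add_distrib, ih, Multiset.map_cons,
      Multiset.sum_cons]
    rw [add_comm]
    congr 1
    simp only [Finset.sum_ite_eq]
    rw [← Finset.card_filter]
    have : (Finset.range n).filter (fun i => a.2 ∈ Finset.Icc (i + 1) n) = Finset.range a.2 := by
      ext x
      simp only [Finset.mem_filter, Finset.mem_range, Finset.mem_Icc]
      omega
    rw [this, Finset.card_range]

lemma deg_sum (v : ℂ) (hv : v ≠ 0) (n : ℕ) (s : Multiset (ℂ × ℕ))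
    (hs : ∀ q ∈ s, q.1 ≠ 0 ∧ 1 ≤ q.2 ∧ q.2 ≤ n) :
    ∑ i ∈ Finset.range n, (extT (dsegMap v n s) i).natDegree = (s.map Prod.snd).sum := by
  rw [← sum_count n s (fun q hq => (hs q hq).2.2)]
  apply Finset.sum_congr rfl
  intro i _
  rw [extT_eq v hv, DD, Polynomial.natDegree_prod]
  · apply Finset.sum_congr rfl
    intro k _
    rw [sclP_natDegree (zpow_ne_zero _ hv)]
    exact (linprod_roots _ (fun q hq => (hs q (Multiset.mem_of_mem_filter hq)).1)).2.2
  · intro k _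
    apply ne_zero_of_c0
    rw [sclP_coeff_zero, PsegP_c0]

lemma exists_seg (n : ℕ) (P : ℕ → Polynomial ℂ) (hP : ∀ k, (P k).coeff 0 = 1) :
    ∃ s : Multiset (ℂ × ℕ), (∀ q ∈ s, q.1 ≠ 0 ∧ 1 ≤ q.2 ∧ q.2 ≤ n) ∧
      ∀ k ∈ Finset.Icc 1 n, PsegP s k = P k := by
  refine ⟨∑ k ∈ Finset.Icc 1 n, (P k).roots.map (fun x => (x⁻¹, k)), ?_, ?_⟩
  · intro q hq
    obtain ⟨k, hk, hq⟩ := Multiset.mem_sum.mp hq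
    obtain ⟨x, hx, rfl⟩ := Multiset.mem_map.mp hq
    refine ⟨?_, Finset.mem_Icc.mp hk⟩
    apply inv_ne_zero
    rintro rfl
    have := (Polynomial.mem_roots'.mp hx).2
    rw [Polynomial.IsRoot, ← Polynomial.coeff_zero_eq_eval_zero, hP] at this
    simp at this
  · intro k hk
    have : (∑ j ∈ Finset.Icc 1 n, (P j).roots.map (fun x => ((x⁻¹, j) : ℂ × ℕ))).filter
        (fun q => q.2 = k) = (P k).roots.map (fun x => (x⁻¹, k)) := by
      rw [← Finset.add_sum_erase _ _ hk, Multiset.filter_add, Multiset.filter_eq_self.mpr,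
        Multiset.filter_eq_nil.mpr, add_zero]
      · intro q hq
        obtain ⟨j, hj, hq⟩ := Multiset.mem_sum.mp hq
        obtain ⟨x, hx, rfl⟩ := Multiset.mem_map.mp hq
        exact (Finset.mem_erase.mp hj).1
      · intro q hq
        obtain ⟨x, hx, rfl⟩ := Multiset.mem_map.mp hq
        rfl
    unfold PsegP
    rw [this, Multiset.map_map]
    exact prod_roots_eq (P k) (hP k)

theorem statement4 (v : ℂ) (hv : v ≠ 0) (hroot : ∀ k : ℕ, 0 < k → v ^ k ≠ 1)
    (n r : ℕ) (hn : 1 ≤ n) (hr : 1 ≤ r) :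
    Set.BijOn (dsegMap v n) (SegSet n r) (QSet v n r) := by
  have hpow : ∀ k : ℕ, v ^ k ≠ 0 := fun k => pow_ne_zero k hv
  refine ⟨?_, ?_, ?_⟩
  · rintro s ⟨hs, hsum⟩
    refine ⟨⟨?_, ?_⟩, ?_⟩
    · intro i
      rw [dsegMap_eq v hv]
      exact DD_c0 v n _ (PsegP_c0 s) i
    · intro m hm
      rw [extT_eq v hv, extT_eq v hv, DD_rec v hv n _ m (by omega)]
      exact dvd_mul_right _ _
    · rw [deg_sum v hv n s hs, hsum]
  · rintro s ⟨hs, -⟩ t ⟨ht, -⟩ hst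
    have hD : ∀ i, DD v n (PsegP s) i = DD v n (PsegP t) i := by
      intro i
      rw [← extT_eq v hv, ← extT_eq v hv, hst]
    have hP : ∀ i, i < n → PsegP s (i + 1) = PsegP t (i + 1) := by
      intro i hi
      have h1 := DD_rec v hv n (PsegP s) i hi
      have h2 := DD_rec v hv n (PsegP t) i hi
      rw [hD i, hD (i + 1), h2] at h1
      refine (mul_left_cancel₀ ?_ h1).symm
      apply ne_zero_of_c0
      rw [sclP_coeff_zero]
      exact DD_c0 v n _ (PsegP_c0 t) _
    ext ⟨a, k⟩
    by_cases hk : 1 ≤ k ∧ k ≤ n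
    · have hf : s.filter (fun q => q.2 = k) = t.filter (fun q => q.2 = k) := by
        rw [filter_eq_roots s (fun q hq => (hs q hq).1), filter_eq_roots t (fun q hq => (ht q hq).1)]
        have := hP (k - 1) (by omega)
        rw [Nat.sub_add_cancel hk.1] at this
        rw [this]
      have := congrArg (Multiset.count (a, k)) hf
      simpa [Multiset.count_filter] using this
    · rw [Multiset.count_eq_zero_of_notMem (fun h => hk (hs _ h).2),
        Multiset.count_eq_zero_of_notMem (fun h => hk (ht _ h).2)]
  · rintro Q ⟨⟨hc, hd⟩, hsum⟩
    have hE0 : ∀ i, (extT Q i).coeff 0 = 1 := by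
      intro i
      unfold extT
      split_ifs with h
      · exact hc _
      · simp
    have hex : ∀ m : ℕ, ∃ p : Polynomial ℂ, p.coeff 0 = 1 ∧
        (m < n → sclP (v ^ m) (extT Q m) = sclP (v ^ (m + 2)) (extT Q (m + 1)) * p) := by
      intro m
      by_cases hm : m < n
      · have hdv : sclP (v ^ (m + 2)) (extT Q (m + 1)) ∣ sclP (v ^ m) (extT Q m) := by
          by_cases hm1 : m + 1 < n
          · exact hd m hm1
          · have : extT Q (m + 1) = 1 := by simp [extT, hm1]
            rw [this, sclP_of_one]
            exact one_dvd _
        obtain ⟨p, hp⟩ := hdv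
        refine ⟨p, ?_, fun _ => hp⟩
        have := congrArg (fun q => Polynomial.coeff q 0) hp
        simpa [Polynomial.mul_coeff_zero, sclP_coeff_zero, hE0] using this.symm
      · exact ⟨1, by simp, fun h => absurd h hm⟩
    choose p hp0 hp using hex
    obtain ⟨s, hs, hsP⟩ := exists_seg n (fun k => p (k - 1)) (fun k => hp0 _)
    have hmain : ∀ j i, i + j = n → DD v n (PsegP s) i = extT Q i := by
      intro j
      induction j with
      | zero =>
        intro i hi
        rw [DD, Finset.Icc_eq_empty (by omega), Finset.prod_empty, extT, dif_neg (by omega)]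
      | succ j ih =>
        intro i hi
        apply sclP_inj (hpow i)
        rw [DD_rec v hv n _ i (by omega), ih (i + 1) (by omega), hp i (by omega),
          hsP (i + 1) (Finset.mem_Icc.mpr (by omega))]
        simp
    have hQ : dsegMap v n s = Q := by
      funext i
      rw [dsegMap_eq v hv, hmain (n - i) i (by omega), extT, dif_pos i.2]
    refine ⟨s, ⟨hs, ?_⟩, hQ⟩
    rw [← deg_sum v hv n s hs, hQ, hsum]

end
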